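/- arXiv:1404.4203 — 2 statements merged into one kernel-verified Lean document; each statement's English description precedes it below -/
import Mathlib

section
/- Let d ≥ 1 be an integer and η ∈ ℝ^d. Let u ∈ C₀^∞(K̄∖{0}) and v_t ∈ C^∞(K̄_t∖{0}) for t = 1,2. Then the following nonlocal Green formula with parameter η holds: Σ_{t=1,2} ∫_{K_t} (−Δu + |η|²u)·conj(v_t) dy + ∫_{γ₁} (u + α·u(χ₁₂ r, φ+φ₁₂))·conj(∂v₁/∂n₁) dγ + ∫_{γ₃} u·conj(∂v₂/∂n₃) dγ + ∫_{γ₂} (∂u/∂n₂)·(conj(v₁) − conj(v₂)) dγ = Σ_{t=1,2} ∫_{K_t} u·conj(−Δv_t + |η|²v_t) dy + ∫_{γ₁} (∂u/∂n₁)·conj(v₁) dγ + ∫_{γ₃} (∂u/∂n₃)·conj(v₂) dγ + ∫_{γ₂} u·conj( ∂v₁/∂n₂ − ∂v₂/∂n₂ + α·χ'₂₁·(∂v₁/∂n₁)(χ'₂₁ r, φ+φ'₂₁) ) dγ. -/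
open MeasureTheory Real Set ComplexConjugate

noncomputable section

/-- Open plane sector `{(r cos θ, r sin θ) : r > 0, a < θ < b}` (polar coordinates). -/
def sector (a b : ℝ) : Set (ℝ × ℝ) :=
  {y | ∃ r θ : ℝ, 0 < r ∧ a < θ ∧ θ < b ∧ y = (r * Real.cos θ, r * Real.sin θ)}

/-- Directional derivative of `W` in the direction `v`. -/
def dd (W : ℝ × ℝ → ℂ) (v : ℝ × ℝ) (y : ℝ × ℝ) : ℂ := fderiv ℝ W y v

/-- Laplacian on `ℝ²`. -/
def lap (W : ℝ × ℝ → ℂ) (y : ℝ × ℝ) : ℂ :=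
  dd (dd W (1, 0)) (1, 0) y + dd (dd W (0, 1)) (0, 1) y

/-- Rotation by the angle `ψ` composed with dilation by the factor `χ`:
in polar coordinates `(r, φ) ↦ (χ r, φ + ψ)`. -/
def rotDil (χ ψ : ℝ) (y : ℝ × ℝ) : ℝ × ℝ :=
  (χ * (y.1 * Real.cos ψ - y.2 * Real.sin ψ), χ * (y.1 * Real.sin ψ + y.2 * Real.cos ψ))

/-- Arclength integral over the ray `φ = b`: `∫_{γ} h dγ = ∫₀^∞ h(r, b) dr`. -/
def rayInt (b : ℝ) (h : ℝ × ℝ → ℂ) : ℂ :=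
  ∫ r in Set.Ioi (0 : ℝ), h (r * Real.cos b, r * Real.sin b)

/-- `W` is smooth on an open neighbourhood of the set `s`
(the formalization of `W ∈ C^∞(s)` for a non-open `s`). -/
def SmoothNear (W : ℝ × ℝ → ℂ) (s : Set (ℝ × ℝ)) : Prop :=
  ∃ O : Set (ℝ × ℝ), IsOpen O ∧ s ⊆ O ∧ ContDiffOn ℝ (⊤ : ℕ∞) W O

/-- Polar coordinates `(r, θ) ↦ (r cos θ, r sin θ)`. -/
def polarMap (p : ℝ × ℝ) : ℝ × ℝ := (p.1 * Real.cos p.2, p.1 * Real.sin p.2)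

theorem contDiff_polarMap : ContDiff ℝ 1 polarMap := by
  unfold polarMap
  fun_prop

theorem hasFDerivAt_polarMap (p : ℝ × ℝ) : HasFDerivAt polarMap (fderivPolarCoordSymm p) p :=
  hasFDerivAt_polarCoord_symm p

theorem sector_eq_image (a b : ℝ) : sector a b = polarMap '' (Ioi 0 ×ˢ Ioo a b) := by
  ext y
  constructor
  · rintro ⟨r, θ, hr, h1, h2, rfl⟩
    exact ⟨(r, θ), ⟨hr, h1, h2⟩, rfl⟩
  · rintro ⟨⟨r, θ⟩, ⟨hr, h1, h2⟩, rfl⟩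
    exact ⟨r, θ, hr, h1, h2, rfl⟩

theorem sector_mono {a b a' b' : ℝ} (ha : a' ≤ a) (hb : b ≤ b') :
    sector a b ⊆ sector a' b' := by
  rintro y ⟨r, θ, hr, h1, h2, rfl⟩
  exact ⟨r, θ, hr, ha.trans_lt h1, h2.trans_le hb, rfl⟩

theorem sq_add_sq_polarMap (p : ℝ × ℝ) : (polarMap p).1 ^ 2 + (polarMap p).2 ^ 2 = p.1 ^ 2 := by
  simp only [polarMap]
  linear_combination p.1 ^ 2 * Real.sin_sq_add_cos_sq p.2

theorem polarMap_ne_zero {p : ℝ × ℝ} (hp : 0 < p.1) : polarMap p ≠ 0 := by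
  intro h
  have := sq_add_sq_polarMap p
  rw [h, Prod.fst_zero, Prod.snd_zero] at this
  nlinarith

theorem injOn_polarMap {a b : ℝ} (hba : b - a < 2 * π) :
    InjOn polarMap (Ioi 0 ×ˢ Ioo a b) := by
  rintro ⟨r, θ⟩ ⟨hr, h1, h2⟩ ⟨s, ψ⟩ ⟨hs, h3, h4⟩ h
  simp only [mem_Ioi] at hr hs h1 h2 h3 h4
  have hrs : r = s := by
    have e1 := sq_add_sq_polarMap (r, θ)
    rw [h, sq_add_sq_polarMap] at e1
    exact ((pow_left_inj₀ hr.le hs.le two_ne_zero).1 e1.symm)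
  subst hrs
  simp only [polarMap, Prod.mk.injEq, mul_eq_mul_left_iff, hr.ne', or_false] at h
  have hc : Real.cos (θ - ψ) = 1 := by
    rw [Real.cos_sub, h.1, h.2]
    nlinarith [Real.sin_sq_add_cos_sq ψ]
  rw [Real.cos_eq_one_iff_of_lt_of_lt (by linarith) (by linarith)] at hc
  rw [sub_eq_zero.1 hc]

theorem measurableSet_sector {a b : ℝ} (hba : b - a < 2 * π) : MeasurableSet (sector a b) := by
  rw [sector_eq_image]
  exact (measurableSet_Ioi.prod measurableSet_Ioo).image_of_continuousOn_injOn
    contDiff_polarMap.continuous.continuousOn (injOn_polarMap hba)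

theorem polarMap_mem_closure_sector {a b : ℝ} (hab : a < b) {p : ℝ × ℝ} (hp : 0 < p.1)
    (hp' : p.2 ∈ Icc a b) : polarMap p ∈ closure (sector a b) \ {0} := by
  refine ⟨?_, polarMap_ne_zero hp⟩
  rw [sector_eq_image]
  refine image_closure_subset_closure_image contDiff_polarMap.continuous ⟨p, ?_, rfl⟩
  rw [closure_prod_eq, closure_Ioo hab.ne]
  exact ⟨subset_closure hp, hp'⟩

theorem sector_subset {a b : ℝ} : sector a b ⊆ closure (sector a b) \ {0} := by
  intro y hy
  refine ⟨subset_closure hy, ?_⟩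
  obtain ⟨r, θ, hr, -, -, rfl⟩ := hy
  exact polarMap_ne_zero (p := (r, θ)) hr

theorem exists_radii {S : Set (ℝ × ℝ)} (hS : IsCompact S) (h0 : (0 : ℝ × ℝ) ∉ S) :
    ∃ ε R : ℝ, 0 < ε ∧ ε < R ∧ ∀ p : ℝ × ℝ, 0 < p.1 → polarMap p ∈ S → p.1 ∈ Ioo ε R := by
  have hρ : Continuous fun y : ℝ × ℝ => √(y.1 ^ 2 + y.2 ^ 2) := by fun_prop
  have hT := hS.image hρ
  have hpol : ∀ p : ℝ × ℝ, 0 < p.1 → polarMap p ∈ S →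
      p.1 ∈ (fun y : ℝ × ℝ => √(y.1 ^ 2 + y.2 ^ 2)) '' S := by
    intro p hp hpS
    refine ⟨_, hpS, ?_⟩
    simp only [sq_add_sq_polarMap, Real.sqrt_sq hp.le]
  have h0T : (0 : ℝ) ∉ (fun y : ℝ × ℝ => √(y.1 ^ 2 + y.2 ^ 2)) '' S := by
    rintro ⟨y, hy, hy0⟩
    have h2 : y.1 ^ 2 + y.2 ^ 2 = 0 := by
      rwa [Real.sqrt_eq_zero (by positivity)] at hy0
    apply h0
    convert hy
    ext
    · simp only [Prod.fst_zero]; nlinarith [sq_nonneg y.1, sq_nonneg y.2]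
    · simp only [Prod.snd_zero]; nlinarith [sq_nonneg y.1, sq_nonneg y.2]
  obtain ⟨ε, hε, hεT⟩ := Metric.isOpen_iff.1 hT.isClosed.isOpen_compl 0 h0T
  obtain ⟨M, hM⟩ := hT.isBounded.subset_closedBall 0
  refine ⟨ε / 2, max ε (M + 1), by positivity, by
    have := le_max_left ε (M + 1); linarith, fun p hp hpS => ⟨?_, ?_⟩⟩
  · by_contra! hle
    refine hεT ?_ (hpol p hp hpS)
    simp only [Metric.mem_ball, dist_zero_right, Real.norm_eq_abs, abs_of_pos hp]
    linarith
  · have := hM (hpol p hp hpS)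
    simp only [Metric.mem_closedBall, dist_zero_right, Real.norm_eq_abs, abs_of_pos hp] at this
    exact lt_of_lt_of_le (by linarith) (le_max_right _ _)

theorem integral_sector {a b : ℝ} (hba : b - a < 2 * π) (F : ℝ × ℝ → ℂ) :
    ∫ y in sector a b, F y = ∫ p in (Ioi 0 ×ˢ Ioo a b : Set (ℝ × ℝ)), (p.1 : ℂ) * F (polarMap p) := by
  rw [sector_eq_image, integral_image_eq_integral_abs_det_fderiv_smul volume
    (measurableSet_Ioi.prod measurableSet_Ioo)
    (fun p _ => (hasFDerivAt_polarMap p).hasFDerivWithinAt) (injOn_polarMap hba)]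
  refine setIntegral_congr_fun (measurableSet_Ioi.prod measurableSet_Ioo) fun p hp => ?_
  simp only [det_fderivPolarCoordSymm, abs_of_pos (show 0 < p.1 from hp.1), Complex.real_smul]

theorem dd_eq_zero {W : ℝ × ℝ → ℂ} {S : Set (ℝ × ℝ)} (hW : tsupport W ⊆ S) {y : ℝ × ℝ}
    (hy : y ∉ S) (v : ℝ × ℝ) : dd W v y = 0 := by
  rw [dd, fderiv_of_notMem_tsupport ℝ (fun h => hy (hW h)), zero_apply]

theorem dd_apply (W : ℝ × ℝ → ℂ) (a b : ℝ) (y : ℝ × ℝ) :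
    dd W (a, b) y = a * dd W (1, 0) y + b * dd W (0, 1) y := by
  have : ((a, b) : ℝ × ℝ) = a • (1, 0) + b • (0, 1) := by simp
  rw [dd, this, map_add, map_smul, map_smul, Complex.real_smul, Complex.real_smul, dd, dd]

theorem integral_sector_div {a b : ℝ} (hab : a < b) (hba : b - a < 2 * π)
    {O S : Set (ℝ × ℝ)} (hO : IsOpen O) (hsub : closure (sector a b) \ {0} ⊆ O)
    (hS : IsCompact S) (h0 : (0 : ℝ × ℝ) ∉ S) {p q : ℝ × ℝ → ℂ}
    (hp : ContDiffOn ℝ 1 p O) (hq : ContDiffOn ℝ 1 q O)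
    (hpS : tsupport p ⊆ S) (hqS : tsupport q ⊆ S) :
    ∫ y in sector a b, (dd p (1, 0) y + dd q (0, 1) y) =
      rayInt b (fun y => -(Real.sin b : ℂ) * p y + (Real.cos b : ℂ) * q y) -
      rayInt a (fun y => -(Real.sin a : ℂ) * p y + (Real.cos a : ℂ) * q y) := by
  obtain ⟨ε, R, hε, hεR, hrad⟩ := exists_radii hS h0
  have hpz : ∀ x : ℝ × ℝ, 0 < x.1 → x.1 ∉ Ioo ε R → p (polarMap x) = 0 := fun x hx hxR =>
    image_eq_zero_of_notMem_tsupport fun h => hxR (hrad x hx (hpS h))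
  have hqz : ∀ x : ℝ × ℝ, 0 < x.1 → x.1 ∉ Ioo ε R → q (polarMap x) = 0 := fun x hx hxR =>
    image_eq_zero_of_notMem_tsupport fun h => hxR (hrad x hx (hqS h))
  have hmaps : MapsTo polarMap (Icc (ε, a) (R, b)) O := fun x hx =>
    hsub (polarMap_mem_closure_sector hab (hε.trans_le hx.1.1) ⟨hx.1.2, hx.2.2⟩)
  have hc := contDiff_polarMap.continuous
  have hcomp : ∀ {F : ℝ × ℝ → ℂ}, ContinuousOn F O →
      ContinuousOn (fun x => F (polarMap x)) (Icc (ε, a) (R, b)) :=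
    fun hF => hF.comp hc.continuousOn hmaps
  have hddc : ∀ {F : ℝ × ℝ → ℂ}, ContDiffOn ℝ 1 F O → ∀ v, ContinuousOn (dd F v) O :=
    fun hF v => (hF.continuousOn_fderiv_of_isOpen hO le_rfl).clm_apply continuousOn_const
  have hdiff : ∀ {F : ℝ × ℝ → ℂ}, ContDiffOn ℝ 1 F O → ∀ x ∈ Icc (ε, a) (R, b),
      HasFDerivAt (fun x => F (polarMap x))
        ((fderiv ℝ F (polarMap x)).comp (fderivPolarCoordSymm x)) x := by
    intro F hF x hx
    have h1 : DifferentiableAt ℝ F (polarMap x) :=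
      (hF.differentiableOn one_ne_zero).differentiableAt (hO.mem_nhds (hmaps hx))
    exact h1.hasFDerivAt.comp x (hasFDerivAt_polarMap x)
  let f : ℝ × ℝ → ℂ := fun x => (x.1 : ℂ) *
    ((Real.cos x.2 : ℂ) * p (polarMap x) + (Real.sin x.2 : ℂ) * q (polarMap x))
  let g : ℝ × ℝ → ℂ := fun x =>
    -(Real.sin x.2 : ℂ) * p (polarMap x) + (Real.cos x.2 : ℂ) * q (polarMap x)
  have hfst : ∀ x : ℝ × ℝ, HasFDerivAt (fun x : ℝ × ℝ => (x.1 : ℂ))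
      (Complex.ofRealCLM.comp (ContinuousLinearMap.fst ℝ ℝ ℝ)) x := fun x =>
    Complex.ofRealCLM.hasFDerivAt.comp x hasFDerivAt_fst
  have hcos : ∀ x : ℝ × ℝ, HasFDerivAt (fun x : ℝ × ℝ => (Real.cos x.2 : ℂ))
      (Complex.ofRealCLM.comp (-Real.sin x.2 • ContinuousLinearMap.snd ℝ ℝ ℝ)) x := fun x =>
    Complex.ofRealCLM.hasFDerivAt.comp x ((hasDerivAt_cos x.2).comp_hasFDerivAt x hasFDerivAt_snd)
  have hsin : ∀ x : ℝ × ℝ, HasFDerivAt (fun x : ℝ × ℝ => (Real.sin x.2 : ℂ))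
      (Complex.ofRealCLM.comp (Real.cos x.2 • ContinuousLinearMap.snd ℝ ℝ ℝ)) x := fun x =>
    Complex.ofRealCLM.hasFDerivAt.comp x ((hasDerivAt_sin x.2).comp_hasFDerivAt x hasFDerivAt_snd)
  have hf : ∀ x ∈ Icc (ε, a) (R, b), DifferentiableAt ℝ f x ∧ DifferentiableAt ℝ g x ∧
      fderiv ℝ f x (1, 0) + fderiv ℝ g x (0, 1) =
        (x.1 : ℂ) * (dd p (1, 0) (polarMap x) + dd q (0, 1) (polarMap x)) := by
    intro x hx
    have h1 := (hfst x).mul (((hcos x).mul (hdiff hp x hx)).add ((hsin x).mul (hdiff hq x hx)))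
    have h2 := ((hsin x).neg.mul (hdiff hp x hx)).add ((hcos x).mul (hdiff hq x hx))
    refine ⟨h1.differentiableAt, h2.differentiableAt, ?_⟩
    have e1 : fderiv ℝ f x = _ := h1.fderiv
    have e2 : fderiv ℝ g x = _ := h2.fderiv
    have k1 : fderivPolarCoordSymm x (1, 0) = (Real.cos x.2, Real.sin x.2) := by
      simp [fderivPolarCoordSymm, Matrix.toLin_finTwoProd_apply]
    have k2 : fderivPolarCoordSymm x (0, 1) = (-x.1 * Real.sin x.2, x.1 * Real.cos x.2) := by
      simp [fderivPolarCoordSymm, Matrix.toLin_finTwoProd_apply]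
    have d1 : ∀ F : ℝ × ℝ → ℂ, ∀ c s : ℝ, fderiv ℝ F (polarMap x) (c, s) =
      c * dd F (1, 0) (polarMap x) + s * dd F (0, 1) (polarMap x) := fun F c s =>
        dd_apply F c s (polarMap x)
    have hsc : (Real.sin x.2 : ℂ) ^ 2 + (Real.cos x.2 : ℂ) ^ 2 = 1 := by
      exact_mod_cast Real.sin_sq_add_cos_sq x.2
    rw [e1, e2]
    simp only [add_apply, smul_apply,
      ContinuousLinearMap.comp_apply, k1, k2, d1, neg_apply,
      ContinuousLinearMap.coe_fst', ContinuousLinearMap.coe_snd', Complex.ofRealCLM_apply,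
      smul_eq_mul, Pi.add_apply, Pi.mul_apply, Pi.neg_apply]
    push_cast at hsc ⊢
    linear_combination (x.1 : ℂ) *
      (dd p (1, 0) (polarMap x) + dd q (0, 1) (polarMap x)) * hsc
  have hbox : ∫ y in sector a b, (dd p (1, 0) y + dd q (0, 1) y) =
      ∫ x in Icc (ε, a) (R, b), (fderiv ℝ f x (1, 0) + fderiv ℝ g x (0, 1)) := by
    rw [integral_sector hba, setIntegral_congr_fun measurableSet_Icc fun x hx => (hf x hx).2.2,
      ← Icc_prod_Icc]
    rw [show (volume : Measure (ℝ × ℝ)).restrict (Icc ε R ×ˢ Icc a b) =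
        volume.restrict (Ioo ε R ×ˢ Ioo a b) from
      Measure.restrict_congr_set (Measure.set_prod_ae_eq Ioo_ae_eq_Icc Ioo_ae_eq_Icc).symm]
    refine setIntegral_eq_of_subset_of_forall_sdiff_eq_zero
      (measurableSet_Ioi.prod measurableSet_Ioo)
      (prod_mono (fun r (hr : r ∈ Ioo ε R) => hε.trans hr.1) subset_rfl) fun x hx => ?_
    have hxS : polarMap x ∉ S := fun h => hx.2 ⟨hrad x hx.1.1 h, hx.1.2⟩
    rw [dd_eq_zero hpS hxS, dd_eq_zero hqS hxS, add_zero, mul_zero]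
  have hray : ∀ θ, rayInt θ (fun y => -(Real.sin θ : ℂ) * p y + (Real.cos θ : ℂ) * q y) =
      ∫ r in ε..R, g (r, θ) := by
    intro θ
    rw [intervalIntegral.integral_of_le hεR.le]
    refine setIntegral_eq_of_subset_of_forall_sdiff_eq_zero measurableSet_Ioi
      (fun r hr => hε.trans hr.1) fun r hr => ?_
    have hr' : r ∉ Ioo ε R := fun h => hr.2 ⟨h.1, h.2.le⟩
    have e1 := hpz (r, θ) hr.1 hr'
    have e2 := hqz (r, θ) hr.1 hr'
    simp only [polarMap] at e1 e2
    simp only [e1, e2, mul_zero, add_zero]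
  have hfz : ∀ r, 0 < r → r ∉ Ioo ε R → ∀ θ, f (r, θ) = 0 := fun r hr hr' θ => by
    simp only [f, hpz (r, θ) hr hr', hqz (r, θ) hr hr', mul_zero, add_zero]
  have hle : ((ε, a) : ℝ × ℝ) ≤ (R, b) := ⟨hεR.le, hab.le⟩
  have key := integral_divergence_prod_Icc_of_hasFDerivAt_off_countable_of_le f g (fderiv ℝ f)
    (fderiv ℝ g) (ε, a) (R, b) hle ∅ countable_empty
    (fun x hx => (hf x hx).1.continuousAt.continuousWithinAt)
    (fun x hx => (hf x hx).2.1.continuousAt.continuousWithinAt)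
    (fun x hx => (hf x ⟨⟨hx.1.1.1.le, hx.1.2.1.le⟩, hx.1.1.2.le, hx.1.2.2.le⟩).1.hasFDerivAt)
    (fun x hx => (hf x ⟨⟨hx.1.1.1.le, hx.1.2.1.le⟩, hx.1.1.2.le, hx.1.2.2.le⟩).2.1.hasFDerivAt)
    (by
      refine ContinuousOn.integrableOn_compact isCompact_Icc ?_
      refine ContinuousOn.congr ?_ fun x hx => (hf x hx).2.2
      exact (Complex.continuous_ofReal.comp continuous_fst).continuousOn.mul
        ((hcomp (hddc hp _)).add (hcomp (hddc hq _))))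
  rw [hbox, key, hray, hray]
  simp only [hfz ε hε (fun h => h.1.false), hfz R (hε.trans hεR) (fun h => h.2.false),
    intervalIntegral.integral_zero, add_zero, sub_zero]

theorem contDiffOn_dd {W : ℝ × ℝ → ℂ} {O : Set (ℝ × ℝ)} (hO : IsOpen O)
    (hW : ContDiffOn ℝ (⊤ : ℕ∞) W O) (v : ℝ × ℝ) : ContDiffOn ℝ (⊤ : ℕ∞) (dd W v) O :=
  (hW.fderiv_of_isOpen hO (m := (⊤ : ℕ∞)) (by simp)).clm_apply contDiffOn_const

theorem continuousOn_lap {W : ℝ × ℝ → ℂ} {O : Set (ℝ × ℝ)} (hO : IsOpen O)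
    (hW : ContDiffOn ℝ (⊤ : ℕ∞) W O) : ContinuousOn (lap W) O :=
  (contDiffOn_dd hO (contDiffOn_dd hO hW _) _).continuousOn.add
    (contDiffOn_dd hO (contDiffOn_dd hO hW _) _).continuousOn

theorem tsupport_dd_subset (W : ℝ × ℝ → ℂ) (v : ℝ × ℝ) : tsupport (dd W v) ⊆ tsupport W :=
  tsupport_fderiv_apply_subset ℝ v

theorem lap_eq_zero {W : ℝ × ℝ → ℂ} {y : ℝ × ℝ} (hy : y ∉ tsupport W) : lap W y = 0 := by
  rw [lap, dd_eq_zero (tsupport_dd_subset W _) hy, dd_eq_zero (tsupport_dd_subset W _) hy,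
    add_zero]

theorem dd_conj (W : ℝ × ℝ → ℂ) (v : ℝ × ℝ) :
    dd (fun y => conj (W y)) v = fun y => conj (dd W v y) := by
  ext1 y
  have := Complex.conjCLE.comp_fderiv (f := W) (x := y)
  exact congrArg (fun L => L v) this

theorem lap_conj (W : ℝ × ℝ → ℂ) (y : ℝ × ℝ) :
    lap (fun y => conj (W y)) y = conj (lap W y) := by
  simp only [lap, dd_conj, map_add]

theorem contDiffOn_conj {W : ℝ × ℝ → ℂ} {O : Set (ℝ × ℝ)}
    (hW : ContDiffOn ℝ (⊤ : ℕ∞) W O) : ContDiffOn ℝ (⊤ : ℕ∞) (fun y => conj (W y)) O :=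
  Complex.conjCLE.contDiff.comp_contDiffOn hW

theorem integrableOn_sector {a b : ℝ} (hba : b - a < 2 * π) {O S : Set (ℝ × ℝ)}
    (hsub : closure (sector a b) \ {0} ⊆ O) (hS : IsCompact S) (h0 : (0 : ℝ × ℝ) ∉ S)
    {F : ℝ × ℝ → ℂ} (hF : ContinuousOn F O) (hz : ∀ y ∉ S, F y = 0) :
    IntegrableOn F (sector a b) := by
  have hK : IsCompact (closure (sector a b) ∩ S) := hS.inter_left isClosed_closure
  have hKO : closure (sector a b) ∩ S ⊆ O := fun y hy =>
    hsub ⟨hy.1, fun h => h0 (by rw [← show y = 0 from h]; exact hy.2)⟩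
  refine ((hF.mono hKO).integrableOn_compact hK).of_forall_sdiff_eq_zero
    (measurableSet_sector hba) fun y hy => hz y fun h => hy.2 ⟨subset_closure hy.1, h⟩

theorem integrableOn_Ioi_of_eq_zero {ε R : ℝ} (hε : 0 < ε) {g : ℝ → ℂ}
    (hg : ContinuousOn g (Ioi 0)) (hz : ∀ r, 0 < r → r ∉ Ioo ε R → g r = 0) :
    IntegrableOn g (Ioi 0) := by
  refine ((hg.mono fun r (hr : r ∈ Icc ε R) => hε.trans_le hr.1).integrableOn_compact
    isCompact_Icc).of_forall_sdiff_eq_zero measurableSet_Ioi fun r hr => hz r hr.1 fun h =>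
      hr.2 ⟨h.1.le, h.2.le⟩

theorem continuousOn_ray {a b θ : ℝ} (hab : a < b) (hθ : θ ∈ Icc a b) {O : Set (ℝ × ℝ)}
    (hsub : closure (sector a b) \ {0} ⊆ O) {F : ℝ × ℝ → ℂ} (hF : ContinuousOn F O) :
    ContinuousOn (fun r : ℝ => F (r * Real.cos θ, r * Real.sin θ)) (Ioi 0) :=
  hF.comp (by fun_prop) fun r hr =>
    hsub (polarMap_mem_closure_sector hab (p := (r, θ)) hr hθ)

theorem integrableOn_ray {a b θ : ℝ} (hab : a < b) (hθ : θ ∈ Icc a b) {O S : Set (ℝ × ℝ)}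
    (hsub : closure (sector a b) \ {0} ⊆ O) (hS : IsCompact S) (h0 : (0 : ℝ × ℝ) ∉ S)
    {F : ℝ × ℝ → ℂ} (hF : ContinuousOn F O) (hz : ∀ y ∉ S, F y = 0) :
    IntegrableOn (fun r : ℝ => F (r * Real.cos θ, r * Real.sin θ)) (Ioi 0) := by
  obtain ⟨ε, R, hε, -, hrad⟩ := exists_radii hS h0
  exact integrableOn_Ioi_of_eq_zero hε (continuousOn_ray hab hθ hsub hF) fun r hr hr' =>
    hz _ fun h => hr' (hrad (r, θ) hr h)

theorem green_sector {a b : ℝ} (hab : a < b) (hba : b - a < 2 * π)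
    {O : Set (ℝ × ℝ)} (hO : IsOpen O) (hsub : closure (sector a b) \ {0} ⊆ O)
    {u w : ℝ × ℝ → ℂ} (hu : ContDiffOn ℝ (⊤ : ℕ∞) u O) (hw : ContDiffOn ℝ (⊤ : ℕ∞) w O)
    (huc : HasCompactSupport u) (hu0 : (0 : ℝ × ℝ) ∉ tsupport u) :
    ∫ y in sector a b, (u y * lap w y - lap u y * w y) =
      rayInt b (fun y => u y * dd w (-Real.sin b, Real.cos b) y -
        dd u (-Real.sin b, Real.cos b) y * w y) -
      rayInt a (fun y => u y * dd w (-Real.sin a, Real.cos a) y -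
        dd u (-Real.sin a, Real.cos a) y * w y) := by
  let X : ℝ × ℝ → ℝ × ℝ → ℂ := fun v y => u y * dd w v y - dd u v y * w y
  have hX : ∀ v, ContDiffOn ℝ 1 (X v) O := fun v =>
    ((hu.mul (contDiffOn_dd hO hw v)).sub ((contDiffOn_dd hO hu v).mul hw)).of_le
      (by exact_mod_cast le_top)
  have hXS : ∀ v, tsupport (X v) ⊆ tsupport u := fun v =>
    closure_minimal (fun y hy => by
      by_contra h
      refine hy ?_
      simp only [X, image_eq_zero_of_notMem_tsupport h, dd_eq_zero subset_rfl h, zero_mul,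
        sub_zero]) isClosed_closure
  have key := integral_sector_div hab hba hO hsub huc hu0 (hX (1, 0)) (hX (0, 1)) (hXS _) (hXS _)
  have hdiff : ∀ {F : ℝ × ℝ → ℂ}, ContDiffOn ℝ (⊤ : ℕ∞) F O → ∀ y ∈ O,
      DifferentiableAt ℝ F y := fun hF y hy =>
    (hF.differentiableOn (by simp)).differentiableAt (hO.mem_nhds hy)
  have hdd : ∀ v, ∀ y ∈ O, dd (X v) v y = u y * dd (dd w v) v y - dd (dd u v) v y * w y := by
    intro v y hy
    have h := ((hdiff hu y hy).hasFDerivAt.mul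
      (hdiff (contDiffOn_dd hO hw v) y hy).hasFDerivAt).sub
      ((hdiff (contDiffOn_dd hO hu v) y hy).hasFDerivAt.mul (hdiff hw y hy).hasFDerivAt)
    have e : dd (X v) v y = _ := congrArg (fun L => L v) h.fderiv
    rw [e]
    simp only [sub_apply, add_apply, smul_apply, smul_eq_mul, dd]
    ring
  have hrays : ∀ θ, rayInt θ (fun y => -(Real.sin θ : ℂ) * X (1, 0) y +
      (Real.cos θ : ℂ) * X (0, 1) y) = rayInt θ (fun y =>
        u y * dd w (-Real.sin θ, Real.cos θ) y - dd u (-Real.sin θ, Real.cos θ) y * w y) := by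
    intro θ
    congr 1
    ext1 y
    rw [dd_apply w, dd_apply u]
    simp only [X]
    push_cast
    ring
  rw [hrays, hrays] at key
  rw [← key]
  refine setIntegral_congr_fun (measurableSet_sector hba) fun y hy => ?_
  have hyO := hsub (sector_subset hy)
  simp only [hdd _ y hyO, lap]
  ring

theorem rayInt_sub {θ : ℝ} {f g : ℝ × ℝ → ℂ}
    (hf : IntegrableOn (fun r : ℝ => f (r * Real.cos θ, r * Real.sin θ)) (Ioi 0))
    (hg : IntegrableOn (fun r : ℝ => g (r * Real.cos θ, r * Real.sin θ)) (Ioi 0)) :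
    rayInt θ (fun y => f y - g y) = rayInt θ f - rayInt θ g :=
  integral_sub hf hg

theorem rayInt_add {θ : ℝ} {f g : ℝ × ℝ → ℂ}
    (hf : IntegrableOn (fun r : ℝ => f (r * Real.cos θ, r * Real.sin θ)) (Ioi 0))
    (hg : IntegrableOn (fun r : ℝ => g (r * Real.cos θ, r * Real.sin θ)) (Ioi 0)) :
    rayInt θ (fun y => f y + g y) = rayInt θ f + rayInt θ g :=
  integral_add hf hg

theorem green_sector_helmholtz {a b : ℝ} (hab : a < b) (hba : b - a < 2 * π)
    {O : Set (ℝ × ℝ)} (hO : IsOpen O) (hsub : closure (sector a b) \ {0} ⊆ O)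
    {u v : ℝ × ℝ → ℂ} (hu : ContDiffOn ℝ (⊤ : ℕ∞) u O) (hv : ContDiffOn ℝ (⊤ : ℕ∞) v O)
    (huc : HasCompactSupport u) (hu0 : (0 : ℝ × ℝ) ∉ tsupport u) (c : ℝ) :
    ∫ y in sector a b, (-(lap u y) + (c : ℂ) * u y) * conj (v y) =
      (∫ y in sector a b, u y * conj (-(lap v y) + (c : ℂ) * v y)) +
      (rayInt b (fun y => u y * conj (dd v (-Real.sin b, Real.cos b) y)) -
        rayInt b (fun y => dd u (-Real.sin b, Real.cos b) y * conj (v y))) -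
      (rayInt a (fun y => u y * conj (dd v (-Real.sin a, Real.cos a) y)) -
        rayInt a (fun y => dd u (-Real.sin a, Real.cos a) y * conj (v y))) := by
  have hconj : ∀ {F : ℝ × ℝ → ℂ}, ContinuousOn F O → ContinuousOn (fun y => conj (F y)) O :=
    fun hF => Complex.continuous_conj.comp_continuousOn hF
  have key := green_sector hab hba hO hsub hu (contDiffOn_conj hv) huc hu0
  have hray : ∀ θ ∈ Icc a b, rayInt θ (fun y => u y * conj (dd v (-Real.sin θ, Real.cos θ) y) -
      dd u (-Real.sin θ, Real.cos θ) y * conj (v y)) =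
      rayInt θ (fun y => u y * conj (dd v (-Real.sin θ, Real.cos θ) y)) -
        rayInt θ (fun y => dd u (-Real.sin θ, Real.cos θ) y * conj (v y)) := by
    intro θ hθ
    refine rayInt_sub
      (integrableOn_ray (F := fun y => u y * conj (dd v (-Real.sin θ, Real.cos θ) y))
        hab hθ hsub huc hu0
        (hu.continuousOn.mul (hconj (contDiffOn_dd hO hv _).continuousOn)) fun y hy => ?_)
      (integrableOn_ray (F := fun y => dd u (-Real.sin θ, Real.cos θ) y * conj (v y))
        hab hθ hsub huc hu0
        ((contDiffOn_dd hO hu _).continuousOn.mul (hconj hv.continuousOn)) fun y hy => ?_)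
    · rw [image_eq_zero_of_notMem_tsupport hy, zero_mul]
    · rw [dd_eq_zero subset_rfl hy, zero_mul]
  simp only [lap_conj, dd_conj] at key
  rw [hray b (right_mem_Icc.2 hab.le), hray a (left_mem_Icc.2 hab.le)] at key
  have hL : IntegrableOn (fun y => (-(lap u y) + (c : ℂ) * u y) * conj (v y)) (sector a b) := by
    refine integrableOn_sector hba hsub huc hu0 (((continuousOn_lap hO hu).neg.add
      (continuousOn_const.mul hu.continuousOn)).mul (hconj hv.continuousOn)) fun y hy => ?_
    rw [lap_eq_zero hy, image_eq_zero_of_notMem_tsupport hy]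
    ring
  have hR : IntegrableOn (fun y => u y * conj (-(lap v y) + (c : ℂ) * v y)) (sector a b) := by
    refine integrableOn_sector hba hsub huc hu0 (hu.continuousOn.mul
      (hconj ((continuousOn_lap hO hv).neg.add
        (continuousOn_const.mul hv.continuousOn)))) fun y hy => ?_
    rw [image_eq_zero_of_notMem_tsupport hy, zero_mul]
  have hsubst : (∫ y in sector a b, (-(lap u y) + (c : ℂ) * u y) * conj (v y)) -
      (∫ y in sector a b, u y * conj (-(lap v y) + (c : ℂ) * v y)) =
      ∫ y in sector a b, (u y * conj (lap v y) - lap u y * conj (v y)) := by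
    rw [← integral_sub hL hR]
    congr 1
    ext1 y
    simp only [map_add, map_neg, map_mul, Complex.conj_ofReal]
    ring
  linear_combination hsubst + key

theorem rotDil_ray (χ ψ r θ : ℝ) : rotDil χ ψ (r * Real.cos θ, r * Real.sin θ) =
    (χ * r * Real.cos (θ + ψ), χ * r * Real.sin (θ + ψ)) := by
  simp only [rotDil, Real.cos_add, Real.sin_add, Prod.mk.injEq]
  constructor <;> ring

/-- Nonlocal Green formula with parameter `η` for `-Δ + |η|²` in the plane angle `K`. -/
theorem green_formula_nonlocal_with_parameter_eta
    (b₁ b₂ b₃ : ℝ) (hb₀ : 0 < b₁) (hb₁₂ : b₁ < b₂) (hb₂₃ : b₂ < b₃) (hb₃ : b₃ < 2 * π)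
    (α χ₁₂ : ℝ) (hχ : 0 < χ₁₂)
    (d : ℕ) (hd : 1 ≤ d) (η : EuclideanSpace ℝ (Fin d))
    (u v₁ v₂ : ℝ × ℝ → ℂ)
    (hu : SmoothNear u (closure (sector b₁ b₃) \ {0}))
    (huc : HasCompactSupport u) (hu0 : (0 : ℝ × ℝ) ∉ tsupport u)
    (hv₁ : SmoothNear v₁ (closure (sector b₁ b₂) \ {0}))
    (hv₂ : SmoothNear v₂ (closure (sector b₂ b₃) \ {0})) :
    ((∫ y in sector b₁ b₂, (-(lap u y) + ((‖η‖ ^ 2 : ℝ) : ℂ) * u y) * conj (v₁ y)) +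
      (∫ y in sector b₂ b₃, (-(lap u y) + ((‖η‖ ^ 2 : ℝ) : ℂ) * u y) * conj (v₂ y))) +
    rayInt b₁ (fun y => (u y + (α : ℂ) * u (rotDil χ₁₂ (b₂ - b₁) y)) *
      conj (dd v₁ (-Real.sin b₁, Real.cos b₁) y)) +
    rayInt b₃ (fun y => u y * conj (dd v₂ (Real.sin b₃, -Real.cos b₃) y)) +
    rayInt b₂ (fun y => dd u (-Real.sin b₂, Real.cos b₂) y * (conj (v₁ y) - conj (v₂ y))) =
    ((∫ y in sector b₁ b₂, u y * conj (-(lap v₁ y) + ((‖η‖ ^ 2 : ℝ) : ℂ) * v₁ y)) +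
      (∫ y in sector b₂ b₃, u y * conj (-(lap v₂ y) + ((‖η‖ ^ 2 : ℝ) : ℂ) * v₂ y))) +
    rayInt b₁ (fun y => dd u (-Real.sin b₁, Real.cos b₁) y * conj (v₁ y)) +
    rayInt b₃ (fun y => dd u (Real.sin b₃, -Real.cos b₃) y * conj (v₂ y)) +
    rayInt b₂ (fun y => u y * conj (dd v₁ (-Real.sin b₂, Real.cos b₂) y -
      dd v₂ (-Real.sin b₂, Real.cos b₂) y +
      (α : ℂ) * ((1 / χ₁₂ : ℝ) : ℂ) *
        dd v₁ (-Real.sin b₁, Real.cos b₁) (rotDil (1 / χ₁₂) (-(b₂ - b₁)) y))) := by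
  obtain ⟨O, hO, hsub, hu⟩ := hu
  obtain ⟨O₁, hO₁, hsub₁, hv₁⟩ := hv₁
  obtain ⟨O₂, hO₂, hsub₂, hv₂⟩ := hv₂
  have hs₁ : closure (sector b₁ b₂) \ {0} ⊆ O ∩ O₁ := subset_inter
    ((sdiff_subset_sdiff_left (closure_mono (sector_mono le_rfl hb₂₃.le))).trans hsub) hsub₁
  have hs₂ : closure (sector b₂ b₃) \ {0} ⊆ O ∩ O₂ := subset_inter
    ((sdiff_subset_sdiff_left (closure_mono (sector_mono hb₁₂.le le_rfl))).trans hsub) hsub₂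
  have hu₁ := hu.mono (inter_subset_left (t := O₁))
  have hu₂ := hu.mono (inter_subset_left (t := O₂))
  replace hv₁ := hv₁.mono (inter_subset_right (s := O))
  replace hv₂ := hv₂.mono (inter_subset_right (s := O))
  replace hO₁ := hO.inter hO₁
  replace hO₂ := hO.inter hO₂
  have green₁ := green_sector_helmholtz hb₁₂ (by linarith) hO₁ hs₁ hu₁ hv₁ huc hu0 (‖η‖ ^ 2)
  have green₂ := green_sector_helmholtz hb₂₃ (by linarith) hO₂ hs₂ hu₂ hv₂ huc hu0 (‖η‖ ^ 2)
  have hconj : ∀ {F : ℝ × ℝ → ℂ} {T : Set (ℝ × ℝ)}, ContinuousOn F T →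
      ContinuousOn (fun y => conj (F y)) T :=
    fun hF => Complex.continuous_conj.comp_continuousOn hF
  have l₁ : b₁ ∈ Icc b₁ b₂ := left_mem_Icc.2 hb₁₂.le
  have r₁ : b₂ ∈ Icc b₁ b₂ := right_mem_Icc.2 hb₁₂.le
  have l₂ : b₂ ∈ Icc b₂ b₃ := left_mem_Icc.2 hb₂₃.le
  have hz : ∀ {F : ℝ × ℝ → ℂ}, ∀ y ∉ tsupport u, u y * F y = 0 := fun y hy => by
    rw [image_eq_zero_of_notMem_tsupport hy, zero_mul]
  have hdz : ∀ {F : ℝ × ℝ → ℂ} {n : ℝ × ℝ}, ∀ y ∉ tsupport u, dd u n y * F y = 0 :=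
    fun y hy => by rw [dd_eq_zero subset_rfl hy, zero_mul]
  set n₁ : ℝ × ℝ := (-Real.sin b₁, Real.cos b₁) with hn₁
  set n₂ : ℝ × ℝ := (-Real.sin b₂, Real.cos b₂) with hn₂
  set n₃ : ℝ × ℝ := (-Real.sin b₃, Real.cos b₃) with hn₃
  have hn₃' : ((Real.sin b₃, -Real.cos b₃) : ℝ × ℝ) = -n₃ := by simp [hn₃]
  have hdv₁ : ContinuousOn (fun y => conj (dd v₁ n₁ y)) (O ∩ O₁) :=
    hconj (contDiffOn_dd hO₁ hv₁ _).continuousOn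
  let N : ℝ × ℝ → ℂ := fun y => u y * ((α : ℂ) * ((1 / χ₁₂ : ℝ) : ℂ) *
    conj (dd v₁ n₁ (rotDil (1 / χ₁₂) (-(b₂ - b₁)) y)))
  have hNz : ∀ y ∉ tsupport u, N y = 0 := fun y hy => by
    simp only [N, image_eq_zero_of_notMem_tsupport hy, zero_mul]
  have hN : IntegrableOn (fun r : ℝ => N (r * Real.cos b₂, r * Real.sin b₂)) (Ioi 0) := by
    obtain ⟨ε, R, hε, -, hrad⟩ := exists_radii huc hu0
    refine integrableOn_Ioi_of_eq_zero (R := R) hε ?_ fun r hr hr' =>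
      hNz _ fun h => hr' (hrad (r, b₂) hr h)
    refine (continuousOn_ray hb₁₂ r₁ hs₁ hu₁.continuousOn).mul (continuousOn_const.mul ?_)
    have h := (continuousOn_ray hb₁₂ l₁ hs₁ hdv₁).comp
      (continuousOn_const.mul continuousOn_id : ContinuousOn (fun r : ℝ => 1 / χ₁₂ * r) (Ioi 0))
      fun r hr => mul_pos (one_div_pos.2 hχ) hr
    refine h.congr fun r _ => ?_
    simp only [rotDil_ray, Function.comp_apply]
    congr 5 <;> ring_nf
  have nonlocal : IntegrableOn (fun r : ℝ => (fun y => (α : ℂ) * u (rotDil χ₁₂ (b₂ - b₁) y) *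
        conj (dd v₁ n₁ y)) (r * Real.cos b₁, r * Real.sin b₁)) (Ioi 0) ∧
      rayInt b₁ (fun y => (α : ℂ) * u (rotDil χ₁₂ (b₂ - b₁) y) * conj (dd v₁ n₁ y)) =
        rayInt b₂ N := by
    have hcomp : ∀ r : ℝ, (α : ℂ) * u (rotDil χ₁₂ (b₂ - b₁) (r * Real.cos b₁, r * Real.sin b₁)) *
        conj (dd v₁ n₁ (r * Real.cos b₁, r * Real.sin b₁)) =
        (χ₁₂ : ℂ) * N (χ₁₂ * r * Real.cos b₂, χ₁₂ * r * Real.sin b₂) := by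
      intro r
      have hχ' : (χ₁₂ : ℂ) ≠ 0 := by exact_mod_cast hχ.ne'
      have e₁ : b₁ + (b₂ - b₁) = b₂ := by ring
      have e₂ : b₂ + -(b₂ - b₁) = b₁ := by ring
      have e₃ : 1 / χ₁₂ * (χ₁₂ * r) = r := by field_simp
      simp only [N, rotDil_ray, e₁, e₂, e₃]
      push_cast
      field_simp
    simp only [rayInt, hcomp]
    constructor
    · have h := (integrableOn_Ioi_comp_mul_left_iff
        (fun r : ℝ => N (r * Real.cos b₂, r * Real.sin b₂)) 0 hχ).2 (by rwa [mul_zero])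
      exact h.const_mul _
    · have h := integral_comp_mul_left_Ioi'
        (fun r : ℝ => N (r * Real.cos b₂, r * Real.sin b₂)) 0 hχ
      rw [mul_zero, Complex.real_smul] at h
      rw [← h, ← integral_const_mul]
  have split₁ : rayInt b₁ (fun y => (u y + (α : ℂ) * u (rotDil χ₁₂ (b₂ - b₁) y)) *
      conj (dd v₁ n₁ y)) = rayInt b₁ (fun y => u y * conj (dd v₁ n₁ y)) + rayInt b₂ N := by
    simp only [add_mul]
    rw [← nonlocal.2]
    exact rayInt_add (integrableOn_ray (F := fun y => u y * conj (dd v₁ n₁ y)) hb₁₂ l₁ hs₁ huc hu0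
      (hu₁.continuousOn.mul hdv₁) hz) nonlocal.1
  have split₂ : rayInt b₂ (fun y => dd u n₂ y * (conj (v₁ y) - conj (v₂ y))) =
      rayInt b₂ (fun y => dd u n₂ y * conj (v₁ y)) -
        rayInt b₂ (fun y => dd u n₂ y * conj (v₂ y)) := by
    simp only [mul_sub]
    exact rayInt_sub
      (integrableOn_ray (F := fun y => dd u n₂ y * conj (v₁ y)) hb₁₂ r₁ hs₁ huc hu0
        ((contDiffOn_dd hO₁ hu₁ _).continuousOn.mul (hconj hv₁.continuousOn)) hdz)
      (integrableOn_ray (F := fun y => dd u n₂ y * conj (v₂ y)) hb₂₃ l₂ hs₂ huc hu0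
        ((contDiffOn_dd hO₂ hu₂ _).continuousOn.mul (hconj hv₂.continuousOn)) hdz)
  have split₃ : rayInt b₂ (fun y => u y * conj (dd v₁ n₂ y - dd v₂ n₂ y +
      (α : ℂ) * ((1 / χ₁₂ : ℝ) : ℂ) * dd v₁ n₁ (rotDil (1 / χ₁₂) (-(b₂ - b₁)) y))) =
      rayInt b₂ (fun y => u y * conj (dd v₁ n₂ y)) -
        rayInt b₂ (fun y => u y * conj (dd v₂ n₂ y)) + rayInt b₂ N := by
    have i₁ := integrableOn_ray (F := fun y => u y * conj (dd v₁ n₂ y)) hb₁₂ r₁ hs₁ huc hu0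
      (hu₁.continuousOn.mul (hconj (contDiffOn_dd hO₁ hv₁ _).continuousOn)) hz
    have i₂ := integrableOn_ray (F := fun y => u y * conj (dd v₂ n₂ y)) hb₂₃ l₂ hs₂ huc hu0
      (hu₂.continuousOn.mul (hconj (contDiffOn_dd hO₂ hv₂ _).continuousOn)) hz
    rw [← rayInt_sub i₁ i₂, ← rayInt_add (i₁.sub i₂) hN]
    simp only [N, map_add, map_sub, map_mul, Complex.conj_ofReal, mul_add, mul_sub]
  have neg₁ : rayInt b₃ (fun y => u y * conj (dd v₂ (-n₃) y)) =
      -rayInt b₃ (fun y => u y * conj (dd v₂ n₃ y)) := by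
    simp only [rayInt, dd, map_neg, mul_neg, integral_neg]
  have neg₂ : rayInt b₃ (fun y => dd u (-n₃) y * conj (v₂ y)) =
      -rayInt b₃ (fun y => dd u n₃ y * conj (v₂ y)) := by
    simp only [rayInt, dd, map_neg, neg_mul, integral_neg]
  rw [split₁, split₂, split₃, hn₃', neg₁, neg₂]
  linear_combination green₁ + green₂
end
end

section
/- Let λ ∈ ℂ, Ũ ∈ C^∞([b₁,b₃];ℂ), Ṽ₁ ∈ C^∞([b₁,b₂];ℂ), Ṽ₂ ∈ C^∞([b₂,b₃];ℂ). Then the following nonlocal Green formula with parameter λ holds: ∫_{b₁}^{b₂} (−Ũ'' + λ²Ũ)·conj(Ṽ₁) dφ + ∫_{b₂}^{b₃} (−Ũ'' + λ²Ũ)·conj(Ṽ₂) dφ + ( Ũ(b₁) + α·exp(iλ ln χ₁₂)·Ũ(b₂) )·conj(Ṽ₁'(b₁)) + Ũ(b₃)·conj(−Ṽ₂'(b₃)) + Ũ'(b₂)·( conj(Ṽ₁(b₂)) − conj(Ṽ₂(b₂)) ) = ∫_{b₁}^{b₂} Ũ·conj(−Ṽ₁'' + conj(λ)²·Ṽ₁)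 dφ + ∫_{b₂}^{b₃} Ũ·conj(−Ṽ₂'' + conj(λ)²·Ṽ₂) dφ + Ũ'(b₁)·conj(Ṽ₁(b₁)) + (−Ũ'(b₃))·conj(Ṽ₂(b₃)) + Ũ(b₂)·conj( Ṽ₁'(b₂) − Ṽ₂'(b₂) + α·exp(i·conj(λ)·ln χ'₂₁)·Ṽ₁'(b₁) ). -/
open MeasureTheory Real ComplexConjugate

noncomputable section

/-- `W : ℝ → ℂ` is smooth on an open neighbourhood of the set `s`
(the formalization of `W ∈ C^∞(s; ℂ)` for a closed interval `s`). -/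
def SmoothNear1 (W : ℝ → ℂ) (s : Set ℝ) : Prop :=
  ∃ O : Set ℝ, IsOpen O ∧ s ⊆ O ∧ ContDiffOn ℝ (⊤ : ℕ∞) W O

theorem SmoothNear1.mono {W : ℝ → ℂ} {s t : Set ℝ} (h : SmoothNear1 W t) (hst : s ⊆ t) :
    SmoothNear1 W s := by
  obtain ⟨O, hO, ht, hW⟩ := h
  exact ⟨O, hO, hst.trans ht, hW⟩

protected theorem SmoothNear1.deriv {W : ℝ → ℂ} {s : Set ℝ} (h : SmoothNear1 W s) :
    SmoothNear1 (deriv W) s := by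
  obtain ⟨O, hO, hs, hW⟩ := h
  exact ⟨O, hO, hs, hW.deriv_of_isOpen hO (by simp)⟩

theorem SmoothNear1.hasDerivAt {W : ℝ → ℂ} {s : Set ℝ} (h : SmoothNear1 W s) {x : ℝ}
    (hx : x ∈ s) : HasDerivAt W (deriv W x) x := by
  obtain ⟨O, hO, hs, hW⟩ := h
  exact ((hW.contDiffAt (hO.mem_nhds (hs hx))).differentiableAt (by simp)).hasDerivAt

theorem SmoothNear1.continuousOn {W : ℝ → ℂ} {s : Set ℝ} (h : SmoothNear1 W s) :
    ContinuousOn W s :=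
  fun _ hx => (h.hasDerivAt hx).continuousAt.continuousWithinAt

/-- Green's formula for the operator `-d²/dφ² + λ²` on a single interval. -/
theorem SmoothNear1.green_formula {a b : ℝ} (hab : a ≤ b) (lam : ℂ) {U V : ℝ → ℂ}
    (hU : SmoothNear1 U (Set.Icc a b)) (hV : SmoothNear1 V (Set.Icc a b)) :
    (∫ φ in a..b, (-(deriv (deriv U) φ) + lam ^ 2 * U φ) * conj (V φ)) =
    (∫ φ in a..b, U φ * conj (-(deriv (deriv V) φ) + (conj lam) ^ 2 * V φ)) +
      (U b * conj (deriv V b) - deriv U b * conj (V b)) -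
      (U a * conj (deriv V a) - deriv U a * conj (V a)) := by
  rw [← Set.uIcc_of_le hab] at hU hV
  have cU := hU.continuousOn
  have conj_cont : Continuous (fun z : ℂ => conj z) := Complex.continuous_conj
  have cV := conj_cont.comp_continuousOn hV.continuousOn
  have cLU : ContinuousOn (fun φ => (-(deriv (deriv U) φ) + lam ^ 2 * U φ) *
      conj (V φ)) (Set.uIcc a b) :=
    (hU.deriv.deriv.continuousOn.neg.add (continuousOn_const.mul cU)).mul cV
  have cLV : ContinuousOn (fun φ => U φ * conj (-(deriv (deriv V) φ) +
      (conj lam) ^ 2 * V φ)) (Set.uIcc a b) :=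
    cU.mul (conj_cont.comp_continuousOn
      (hV.deriv.deriv.continuousOn.neg.add (continuousOn_const.mul hV.continuousOn)))
  have ftc := intervalIntegral.integral_eq_sub_of_hasDerivAt
    (f := fun φ => U φ * conj (deriv V φ) - deriv U φ * conj (V φ))
    (f' := fun φ => (-(deriv (deriv U) φ) + lam ^ 2 * U φ) * conj (V φ) -
      U φ * conj (-(deriv (deriv V) φ) + (conj lam) ^ 2 * V φ))
    (fun x hx => by
      refine (((hU.hasDerivAt hx).mul (hV.deriv.hasDerivAt hx).star).sub
        ((hU.deriv.hasDerivAt hx).mul (hV.hasDerivAt hx).star)).congr_deriv ?_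
      simp only [map_add, map_neg, map_mul, map_pow, Complex.conj_conj, ← starRingEnd_apply]
      ring)
    (cLU.sub cLV).intervalIntegrable
  rw [intervalIntegral.integral_sub cLU.intervalIntegrable cLV.intervalIntegrable] at ftc
  linear_combination ftc

/-- Nonlocal Green formula with spectral parameter `λ` on the arcs `(b₁, b₂)`, `(b₂, b₃)`,
corresponding to the nonlocal Dirichlet-type boundary condition. -/
theorem green_formula_nonlocal_parameter_lambda_dirichlet
    (b₁ b₂ b₃ : ℝ) (hb₀ : 0 < b₁) (hb₁₂ : b₁ < b₂) (hb₂₃ : b₂ < b₃) (hb₃ : b₃ < 2 * π)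
    (α χ₁₂ : ℝ) (hχ : 0 < χ₁₂) (lam : ℂ)
    (U V₁ V₂ : ℝ → ℂ)
    (hU : SmoothNear1 U (Set.Icc b₁ b₃))
    (hV₁ : SmoothNear1 V₁ (Set.Icc b₁ b₂))
    (hV₂ : SmoothNear1 V₂ (Set.Icc b₂ b₃)) :
    (∫ φ in b₁..b₂, (-(deriv (deriv U) φ) + lam ^ 2 * U φ) * conj (V₁ φ)) +
    (∫ φ in b₂..b₃, (-(deriv (deriv U) φ) + lam ^ 2 * U φ) * conj (V₂ φ)) +
    (U b₁ + (α : ℂ) * Complex.exp (Complex.I * lam * (Real.log χ₁₂ : ℂ)) * U b₂) *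
      conj (deriv V₁ b₁) +
    U b₃ * conj (-(deriv V₂ b₃)) +
    deriv U b₂ * (conj (V₁ b₂) - conj (V₂ b₂)) =
    (∫ φ in b₁..b₂, U φ * conj (-(deriv (deriv V₁) φ) + (conj lam) ^ 2 * V₁ φ)) +
    (∫ φ in b₂..b₃, U φ * conj (-(deriv (deriv V₂) φ) + (conj lam) ^ 2 * V₂ φ)) +
    deriv U b₁ * conj (V₁ b₁) +
    (-(deriv U b₃)) * conj (V₂ b₃) +
    U b₂ * conj (deriv V₁ b₂ - deriv V₂ b₂ +
      (α : ℂ) * Complex.exp (Complex.I * conj lam * (Real.log (1 / χ₁₂) : ℂ)) * deriv V₁ b₁) := by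
  have hexp : conj (Complex.exp (Complex.I * conj lam * (Real.log (1 / χ₁₂) : ℂ))) =
      Complex.exp (Complex.I * lam * (Real.log χ₁₂ : ℂ)) := by
    rw [← Complex.exp_conj]
    simp
  rw [(hU.mono (Set.Icc_subset_Icc_right hb₂₃.le)).green_formula hb₁₂.le lam hV₁,
    (hU.mono (Set.Icc_subset_Icc_left hb₁₂.le)).green_formula hb₂₃.le lam hV₂]
  simp only [map_add, map_sub, map_neg, map_mul, hexp, Complex.conj_ofReal]
  ring
end
end
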